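/- Let A, B ∈ ℝ and f_{A,B}(X) = X³ + AX + B. Then the Julia set of f_{A,B} is contained in ℝ if and only if A ≤ −3 and B² ≤ −4A(A+3)²/27. -/

import Mathlib

open Bornology

/-- The filled Julia set of the cubic map `z ↦ z³ + Az + B`. -/
def filledJuliaCubic (A B : ℝ) : Set ℂ :=
  {z : ℂ | IsBounded
    (Set.range fun n : ℕ => (fun w : ℂ => w ^ 3 + (A : ℂ) * w + (B : ℂ))^[n] z)}

/-- A point whose image is fixed by `f_{A,B}` lies in the filled Julia set. -/
lemma mem_filledJuliaCubic_of_map_fixed {A B : ℝ} {z p : ℂ} (hz : z ^ 3 + A * z + B = p)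
    (hp : p ^ 3 + A * p + B = p) : z ∈ filledJuliaCubic A B := by
  refine ((Set.finite_singleton p).insert z).isBounded.subset ?_
  rintro _ ⟨n, rfl⟩
  cases n with
  | zero => simp
  | succ n =>
    right
    simp only [Function.iterate_succ_apply, hz]
    exact Function.iterate_fixed hp n

/-- If a nonnegative function dominated by an affine function of the norm is multiplied by at
least `2` at each step of an orbit, then it vanishes along bounded orbits. -/
lemma not_isBounded_range_iterate {f : ℂ → ℂ} {φ : ℂ → ℝ} {a b : ℝ} (ha : 0 ≤ a)
    (hφ : ∀ w, φ w ≤ a * ‖w‖ + b) (S : Set ℂ) (hS : ∀ w ∈ S, f w ∈ S)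
    (hstep : ∀ w ∈ S, 2 * φ w ≤ φ (f w)) {z : ℂ} (hzS : z ∈ S) (hz : 0 < φ z) :
    ¬ IsBounded (Set.range fun n : ℕ => f^[n] z) := by
  intro hb
  obtain ⟨C, hC⟩ := hb.exists_norm_le
  have key : ∀ n : ℕ, f^[n] z ∈ S ∧ 2 ^ n * φ z ≤ φ (f^[n] z) := by
    intro n
    induction n with
    | zero => simpa using hzS
    | succ n ih =>
      rw [Function.iterate_succ_apply']
      refine ⟨hS _ ih.1, ?_⟩
      have := hstep _ ih.1
      rw [pow_succ]
      linarith [ih.2]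
  obtain ⟨n, hn⟩ := pow_unbounded_of_one_lt ((a * C + b) / φ z) (one_lt_two)
  rw [div_lt_iff₀ hz] at hn
  have h1 := hφ (f^[n] z)
  have h2 := mul_le_mul_of_nonneg_left (hC _ ⟨n, rfl⟩) ha
  linarith [(key n).2]

/-- An escape radius for `f_{A,B}`. -/
lemma norm_le_of_mem_filledJuliaCubic {A B : ℝ} {z : ℂ} (hz : z ∈ filledJuliaCubic A B) :
    ‖z‖ ≤ 2 + |A| + |B| := by
  by_contra! h
  have hA := abs_nonneg A
  have hB := abs_nonneg B
  have hstep : ∀ w : ℂ, 2 + |A| + |B| < ‖w‖ → 2 * ‖w‖ ≤ ‖w ^ 3 + (A : ℂ) * w + (B : ℂ)‖ := by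
    intro w hw
    have h1 : ‖w ^ 3‖ ≤ ‖w ^ 3 + (A : ℂ) * w + (B : ℂ)‖ + ‖(A : ℂ) * w‖ + ‖(B : ℂ)‖ := by
      have e : w ^ 3 = (w ^ 3 + (A : ℂ) * w + (B : ℂ)) - (A : ℂ) * w - (B : ℂ) := by ring
      conv_lhs => rw [e]
      exact (norm_sub_le _ _).trans (by gcongr; exact norm_sub_le _ _)
    simp only [norm_pow, norm_mul, Complex.norm_real, Real.norm_eq_abs] at h1
    nlinarith [mul_nonneg hB (show 0 ≤ ‖w‖ - 1 by linarith),
      mul_nonneg (norm_nonneg w) (show 0 ≤ ‖w‖ ^ 2 - |A| - |B| - 2 by nlinarith)]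
  refine not_isBounded_range_iterate (φ := fun w => ‖w‖) (a := 1) (b := 0) zero_le_one
    (by simp) {w | 2 + |A| + |B| < ‖w‖} (fun w hw => ?_) hstep h
    (by linarith) hz
  simp only [Set.mem_ofPred_eq] at hw ⊢
  linarith [hstep w hw]

/-- A preconnected set meeting both a set and its complement meets the frontier. -/
lemma IsPreconnected.inter_frontier_nonempty {X : Type*} [TopologicalSpace X] {s t : Set X}
    (ht : IsPreconnected t) (hs : (t ∩ s).Nonempty) (hsc : (t ∩ sᶜ).Nonempty) :
    (t ∩ frontier s).Nonempty := by
  by_contra hempty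
  have hfr : ∀ x ∈ t, x ∈ closure s → x ∈ interior s := fun x hx hxc => by
    by_contra hxi
    exact hempty ⟨x, hx, hxc, hxi⟩
  obtain ⟨x, hxt, hxs⟩ := hs
  obtain ⟨y, hyt, hys⟩ := hsc
  obtain ⟨w, -, hwi, hwc⟩ := ht (interior s) (closure s)ᶜ isOpen_interior
    isClosed_closure.isOpen_compl (fun x hx => or_iff_not_imp_right.2 fun h => hfr x hx (not_not.1 h))
    ⟨x, hxt, hfr x hxt (subset_closure hxs)⟩
    ⟨y, hyt, fun h => hys (interior_subset (hfr y hyt h))⟩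
  exact hwc (subset_closure (interior_subset hwi))

/-- A radially bounded set whose frontier is real is itself real. -/
lemma subset_range_ofReal_of_frontier {K : Set ℂ} {R : ℝ} (hK : ∀ z ∈ K, ‖z‖ ≤ R)
    (hfr : frontier K ⊆ Set.range ((↑) : ℝ → ℂ)) : K ⊆ Set.range ((↑) : ℝ → ℂ) := by
  intro z hz
  by_contra hreal
  have him : z.im ≠ 0 := fun h => hreal ⟨z.re, Complex.ext (by simp) (by simp [h])⟩
  have hpos : 0 < ‖z‖ := norm_pos_iff.2 fun h => him (by simp [h])
  obtain ⟨n, hn⟩ := exists_nat_gt (R / ‖z‖)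
  rw [div_lt_iff₀ hpos] at hn
  set t : Set ℂ := (fun r : ℝ => (r : ℂ) * z) '' Set.Ici 1
  have ht : IsPreconnected t :=
    isPreconnected_Ici.image _ (by fun_prop)
  obtain ⟨w, ⟨r, hr, rfl⟩, hw⟩ := ht.inter_frontier_nonempty (s := K)
    ⟨z, ⟨1, by simp, by simp⟩, hz⟩
    ⟨((n + 1 : ℝ) : ℂ) * z, ⟨n + 1, by simp, rfl⟩, fun h => by
      have := hK _ h
      rw [norm_mul, Complex.norm_real, Real.norm_eq_abs, abs_of_nonneg (by positivity)] at this
      linarith⟩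
  obtain ⟨x, hx⟩ := hfr hw
  have := congrArg Complex.im hx
  simp only [Complex.ofReal_im, Complex.im_ofReal_mul, zero_eq_mul, him,
    or_false] at this
  simp only [Set.mem_Ici] at hr
  linarith

/-- If the filled Julia set is real then the preimages of a real fixed point `p` are real, so the
quadratic `(f(X) - p) / (X - p)` has nonnegative discriminant. -/
lemma sq_le_of_fixed {A B p : ℝ} (hK : filledJuliaCubic A B ⊆ Set.range ((↑) : ℝ → ℂ))
    (hp : p ^ 3 + A * p + B = p) : 3 * p ^ 2 ≤ -4 * A := by
  by_contra! h
  have hd : 0 < 3 * p ^ 2 + 4 * A := by linarith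
  set s := √(3 * p ^ 2 + 4 * A) with hs
  have hs2 : s ^ 2 = 3 * p ^ 2 + 4 * A := Real.sq_sqrt hd.le
  have hpC : (p : ℂ) ^ 3 + A * p + B = p := by exact_mod_cast hp
  have hsC : (s : ℂ) ^ 2 = 3 * (p : ℂ) ^ 2 + 4 * A := by exact_mod_cast hs2
  obtain ⟨x, hx⟩ := hK (mem_filledJuliaCubic_of_map_fixed (A := A) (B := B) (p := p)
    (z := (-p + s * Complex.I) / 2) (by
      have hI : Complex.I ^ 2 = -1 := Complex.I_sq
      have hq : ((-p + s * Complex.I) / 2) ^ 2 + p * ((-p + s * Complex.I) / 2) + (p : ℂ) ^ 2 + A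
          = 0 := by
        linear_combination (1 / 4) * (s : ℂ) ^ 2 * hI - (1 / 4) * hsC
      linear_combination ((-p + s * Complex.I) / 2 - p) * hq + hpC) hpC)
  have him := congrArg Complex.im hx
  have : s = 0 := by simpa using him.symm
  have : 0 < s := Real.sqrt_pos.2 hd
  linarith

/-- A monic real depressed cubic that is negative at `a` has a root beyond `a`. -/
lemma exists_cubic_root_gt {C B a : ℝ} (h : a ^ 3 + C * a + B < 0) :
    ∃ p, a < p ∧ p ^ 3 + C * p + B = 0 := by
  set M := 1 + |a| + |C| + |B|
  have haM : a ≤ M := by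
    have := le_abs_self a
    have := abs_nonneg C
    have := abs_nonneg B
    simp only [M]; linarith
  have hM : 0 ≤ M ^ 3 + C * M + B := by
    have h1 : 1 ≤ M := by simp only [M]; have := abs_nonneg a; have := abs_nonneg C
                          have := abs_nonneg B; linarith
    have h2 : |C| + |B| ≤ M := by simp only [M]; linarith [abs_nonneg a]
    have h3 := neg_abs_le C
    have h4 := neg_abs_le B
    nlinarith [mul_nonneg (abs_nonneg B) (sub_nonneg.2 h1),
      mul_nonneg (show 0 ≤ M by linarith) (show 0 ≤ M ^ 2 - |C| - |B| by nlinarith),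
      mul_nonneg (show 0 ≤ M by linarith) (show 0 ≤ C + |C| by linarith)]
  obtain ⟨p, hp, hp0⟩ := intermediate_value_Icc haM
    (f := fun x => x ^ 3 + C * x + B) (by fun_prop) ⟨h.le, hM⟩
  refine ⟨p, lt_of_le_of_ne hp.1 ?_, hp0⟩
  rintro rfl
  exact h.ne hp0

/-- If the filled Julia set is real then `A` and `B` satisfy the stated inequalities. -/
lemma bounds_of_filledJuliaCubic_real {A B : ℝ}
    (hK : filledJuliaCubic A B ⊆ Set.range ((↑) : ℝ → ℂ)) :
    A ≤ -3 ∧ B ^ 2 ≤ -4 * A * (A + 3) ^ 2 / 27 := by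
  have hfix : ∀ p : ℝ, p ^ 3 + (A - 1) * p + B = 0 → 3 * p ^ 2 ≤ -4 * A := fun p hp =>
    sq_le_of_fixed hK (by linarith)
  have hA : A ≤ 0 := by
    rcases lt_or_ge B 0 with hB | hB
    · obtain ⟨p, -, hp⟩ := exists_cubic_root_gt (C := A - 1) (B := B) (a := 0) (by simpa)
      nlinarith [hfix p hp, sq_nonneg p]
    · rcases hB.eq_or_lt with rfl | hB
      · have := hfix 0 (by simp); linarith
      · obtain ⟨p, -, hp⟩ := exists_cubic_root_gt (C := A - 1) (B := -B) (a := 0) (by simpa)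
        nlinarith [hfix (-p) (by linear_combination -hp), sq_nonneg p]
  obtain ⟨c, hc, rfl⟩ : ∃ c : ℝ, 0 ≤ c ∧ A = -3 * c ^ 2 :=
    ⟨√(-A / 3), Real.sqrt_nonneg _, by rw [Real.sq_sqrt (by linarith)]; ring⟩
  have hfix' : ∀ p : ℝ, 2 * c < p → p ^ 3 + (-3 * c ^ 2 - 1) * p + B ≠ 0 := fun p hp h => by
    nlinarith [hfix p h]
  have hfix'' : ∀ p : ℝ, 2 * c < p → p ^ 3 + (-3 * c ^ 2 - 1) * p - B ≠ 0 := fun p hp h => by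
    nlinarith [hfix (-p) (by linear_combination -h)]
  have h1 : 0 ≤ (2 * c) ^ 3 + (-3 * c ^ 2 - 1) * (2 * c) + B := by
    by_contra! h
    obtain ⟨p, hp, h0⟩ := exists_cubic_root_gt h
    exact hfix' p hp h0
  have h2 : 0 ≤ (2 * c) ^ 3 + (-3 * c ^ 2 - 1) * (2 * c) + -B := by
    by_contra! h
    obtain ⟨p, hp, h0⟩ := exists_cubic_root_gt h
    exact hfix'' p hp h0
  have h3 : 0 ≤ c * (c ^ 2 - 1) := by nlinarith
  have hc0 : 0 < c := by
    rcases hc.eq_or_lt with rfl | h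
    · exact absurd (show (1 : ℝ) ^ 3 + (-3 * 0 ^ 2 - 1) * 1 + B = 0 by linarith)
        (hfix' 1 (by simp))
    · exact h
  have h4 : 0 ≤ c ^ 2 - 1 := nonneg_of_mul_nonneg_right h3 hc0
  refine ⟨by linarith, ?_⟩
  have := mul_nonneg h1 h2
  linarith

/-- The sum of the distances from the Joukowski point `c(w + w⁻¹)` to the foci `±2c`. -/
lemma norm_sub_add_norm_add_joukowski {c : ℝ} (hc : 0 < c) {w : ℂ} (hw : w ≠ 0) :
    ‖c * (w + w⁻¹) - 2 * c‖ + ‖c * (w + w⁻¹) + 2 * c‖ = 2 * c * (‖w‖ + ‖w‖⁻¹) := by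
  have hn : ‖w‖ ≠ 0 := norm_ne_zero_iff.2 hw
  have e1 : (c : ℂ) * (w + w⁻¹) - 2 * c = c * (w - 1) ^ 2 / w := by field_simp; ring
  have e2 : (c : ℂ) * (w + w⁻¹) + 2 * c = c * (w + 1) ^ 2 / w := by field_simp; ring
  rw [e1, e2]
  simp only [norm_div, norm_mul, norm_pow, Complex.norm_real, Real.norm_eq_abs, abs_of_pos hc]
  have hp := parallelogram_law_with_norm ℝ w 1
  rw [norm_one] at hp
  field_simp
  linarith

/-- Focal distance sum of the Chebyshev cubic `z³ - 3c²z`, divided by `c²`. -/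
lemma focal_sum_chebyshev {c : ℝ} (hc : 0 < c) (z : ℂ) {e : ℝ}
    (he : ‖z - 2 * c‖ + ‖z + 2 * c‖ = 2 * c * e) :
    ‖(z ^ 3 - 3 * c ^ 2 * z) / c ^ 2 - 2 * c‖ + ‖(z ^ 3 - 3 * c ^ 2 * z) / c ^ 2 + 2 * c‖
      = 2 * c * (e ^ 3 - 3 * e) := by
  have hcC : (c : ℂ) ≠ 0 := by exact_mod_cast hc.ne'
  obtain ⟨w, hw⟩ : ∃ w : ℂ, w ≠ 0 ∧ z = c * (w + w⁻¹) := by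
    obtain ⟨s, hs⟩ := IsAlgClosed.exists_pow_nat_eq ((z / c) ^ 2 - 4) (n := 2) (by norm_num)
    have hw : ((z / c + s) / 2) * ((z / c - s) / 2) = 1 := by linear_combination -(1 / 4) * hs
    refine ⟨(z / c + s) / 2, left_ne_zero_of_mul_eq_one hw, ?_⟩
    rw [inv_eq_of_mul_eq_one_right hw]
    field_simp
    ring
  obtain ⟨hw, rfl⟩ := hw
  have e3 : ((c * (w + w⁻¹)) ^ 3 - 3 * c ^ 2 * (c * (w + w⁻¹))) / (c : ℂ) ^ 2
      = c * (w ^ 3 + (w ^ 3)⁻¹) := by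
    field_simp
    ring
  have hn : ‖w‖ ≠ 0 := norm_ne_zero_iff.2 hw
  rw [e3, norm_sub_add_norm_add_joukowski hc (pow_ne_zero 3 hw), norm_pow]
  rw [norm_sub_add_norm_add_joukowski hc hw] at he
  have : e = ‖w‖ + ‖w‖⁻¹ := by
    have h2c : 2 * c ≠ 0 := by positivity
    exact (mul_left_cancel₀ h2c he).symm
  rw [this]
  field_simp
  ring

/-- An affine map `u ↦ a u + B` with `a ≥ 1` that stretches `[-2c, 2c]` over itself does not
decrease the sum of the distances to `±2c`. -/
lemma focal_sum_le_affine {a c B : ℝ} (ha : 1 ≤ a) (hc : 0 ≤ c) (hB : |B| ≤ 2 * c * (a - 1))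
    (u : ℂ) : ‖u - 2 * c‖ + ‖u + 2 * c‖ ≤ ‖a * u + B - 2 * c‖ + ‖a * u + B + 2 * c‖ := by
  have ha0 : 0 < a := by linarith
  obtain ⟨hB1, hB2⟩ := abs_le.1 hB
  have h1 : ‖(a : ℂ) * (u - 2 * c)‖ ≤ ‖a * u + B - 2 * c‖ + (2 * c * (a - 1) + B) := by
    have e : (a : ℂ) * (u - 2 * c) = (a * u + B - 2 * c) - ((2 * c * (a - 1) + B : ℝ) : ℂ) := by
      push_cast; ring
    rw [e]
    refine (norm_sub_le _ _).trans (le_of_eq ?_)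
    rw [Complex.norm_real, Real.norm_eq_abs, abs_of_nonneg (by linarith)]
  have h2 : ‖(a : ℂ) * (u + 2 * c)‖ ≤ ‖a * u + B + 2 * c‖ + (2 * c * (a - 1) - B) := by
    have e : (a : ℂ) * (u + 2 * c) = (a * u + B + 2 * c) + ((2 * c * (a - 1) - B : ℝ) : ℂ) := by
      push_cast; ring
    rw [e]
    refine (norm_add_le _ _).trans (le_of_eq ?_)
    rw [Complex.norm_real, Real.norm_eq_abs, abs_of_nonneg (by linarith)]
  have h3 : 4 * c ≤ ‖a * u + B - 2 * c‖ + ‖a * u + B + 2 * c‖ := by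
    have e : ((4 * c : ℝ) : ℂ) = (a * u + B + 2 * c) - (a * u + B - 2 * c) := by
      push_cast; ring
    calc 4 * c = ‖((4 * c : ℝ) : ℂ)‖ := by
          rw [Complex.norm_real, Real.norm_eq_abs, abs_of_nonneg (by linarith)]
      _ ≤ _ := by rw [e]; exact (norm_sub_le _ _).trans_eq (add_comm _ _)
  rw [norm_mul, Complex.norm_real, Real.norm_eq_abs, abs_of_pos ha0] at h1 h2
  refine le_of_mul_le_mul_left ?_ ha0
  nlinarith

/-- A point whose distances to `±2c` sum to at most `4c` is real. -/
lemma im_eq_zero_of_focal_sum_le {c : ℝ} {z : ℂ} (h : ‖z - 2 * c‖ + ‖z + 2 * c‖ ≤ 4 * c) :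
    z.im = 0 := by
  have h1 : 2 * c - z.re ≤ ‖z - 2 * c‖ := by
    simpa using (neg_le_abs _).trans (Complex.abs_re_le_norm (z - 2 * c))
  have h2 : z.re + 2 * c ≤ ‖z + 2 * c‖ := by
    simpa using Complex.re_le_norm (z + 2 * c)
  have h3 : ‖z - 2 * c‖ = 2 * c - z.re := by linarith
  have h4 : ‖z - 2 * c‖ ^ 2 = (z.re - 2 * c) ^ 2 + z.im ^ 2 := by
    rw [Complex.sq_norm, Complex.normSq_apply]; simp; ring
  rw [h3] at h4
  exact pow_eq_zero_iff two_ne_zero |>.1 (by linarith)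

/-- If the critical values of `f` with critical points `±c` lie outside `(-2c, 2c)`, then the
filled Julia set of `f` is real. -/
lemma filledJuliaCubic_real {c B : ℝ} (hc : 1 ≤ c) (hB : |B| ≤ 2 * c * (c ^ 2 - 1)) :
    filledJuliaCubic (-3 * c ^ 2) B ⊆ Set.range ((↑) : ℝ → ℂ) := by
  intro z hz
  have hc0 : 0 < c := by linarith
  have hcC : (c : ℂ) ≠ 0 := by exact_mod_cast hc0.ne'
  suffices him : z.im = 0 from ⟨z.re, Complex.ext (by simp) (by simp [him])⟩
  by_contra him
  set φ : ℂ → ℝ := fun w => (‖w - 2 * c‖ + ‖w + 2 * c‖) / (2 * c) - 2 with hφ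
  have hstep : ∀ w, 0 < φ w →
      2 * φ w ≤ φ (w ^ 3 + ((-3 * c ^ 2 : ℝ) : ℂ) * w + (B : ℂ)) := by
    intro w hw
    have h1 := focal_sum_chebyshev hc0 w (e := φ w + 2) (by simp only [hφ]; field_simp; ring)
    have h2 := focal_sum_le_affine (one_le_pow₀ hc : 1 ≤ c ^ 2) hc0.le hB
      ((w ^ 3 - 3 * c ^ 2 * w) / c ^ 2)
    have e : ((c ^ 2 : ℝ) : ℂ) * ((w ^ 3 - 3 * c ^ 2 * w) / c ^ 2) + B
        = w ^ 3 + ((-3 * c ^ 2 : ℝ) : ℂ) * w + (B : ℂ) := by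
      push_cast; field_simp; ring
    rw [h1, e] at h2
    have h3 : (φ w + 2) ^ 3 - 3 * (φ w + 2) - 2
        ≤ φ (w ^ 3 + ((-3 * c ^ 2 : ℝ) : ℂ) * w + (B : ℂ)) := by
      simp only [hφ] at h2 ⊢
      gcongr
      rw [le_div_iff₀ (by positivity)]
      linarith
    nlinarith [pow_pos hw 2, pow_pos hw 3]
  have hbound : ∀ w, φ w ≤ c⁻¹ * ‖w‖ + 0 := by
    intro w
    have n : ‖(2 * c : ℂ)‖ = 2 * c := by simp [abs_of_pos hc0]
    have h1 := norm_sub_le w (2 * c)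
    have h2 := norm_add_le w (2 * c)
    rw [n] at h1 h2
    simp only [hφ]
    rw [sub_le_iff_le_add, div_le_iff₀ (by positivity)]
    have : (c⁻¹ * ‖w‖ + 0 + 2) * (2 * c) = 2 * ‖w‖ + 4 * c := by field_simp; ring
    linarith
  have hpos : 0 < φ z := by
    by_contra! h
    refine him (im_eq_zero_of_focal_sum_le (c := c) ?_)
    simp only [hφ] at h
    rw [sub_nonpos, div_le_iff₀ (by positivity)] at h
    linarith
  exact not_isBounded_range_iterate (inv_nonneg.2 hc0.le) hbound {w | 0 < φ w}
    (fun w hw => by simp only [Set.mem_ofPred_eq] at hw ⊢; linarith [hstep w hw])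
    hstep hpos hpos hz

/-- The Julia set of `f_{A,B}(X) = X³ + AX + B`, i.e. the boundary of the filled Julia
set, is contained in `ℝ` if and only if `A ≤ -3` and `B² ≤ -4A(A + 3)²/27`. -/
theorem julia_cubic_real_iff (A B : ℝ) :
    frontier (filledJuliaCubic A B) ⊆ Set.range ((↑) : ℝ → ℂ) ↔
      A ≤ -3 ∧ B ^ 2 ≤ -4 * A * (A + 3) ^ 2 / 27 := by
  constructor
  · intro h
    exact bounds_of_filledJuliaCubic_real
      (subset_range_ofReal_of_frontier (fun _ => norm_le_of_mem_filledJuliaCubic) h)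
  · rintro ⟨hA, hB⟩
    obtain ⟨c, hc, rfl⟩ : ∃ c : ℝ, 0 ≤ c ∧ A = -3 * c ^ 2 :=
      ⟨√(-A / 3), Real.sqrt_nonneg _, by rw [Real.sq_sqrt (by linarith)]; ring⟩
    have hc1 : 1 ≤ c := by nlinarith
    have hB' : |B| ≤ 2 * c * (c ^ 2 - 1) :=
      abs_le_of_sq_le_sq (by linarith) (mul_nonneg (by linarith) (by nlinarith))
    have hclosed : IsClosed (Set.range ((↑) : ℝ → ℂ)) :=
      Complex.isometry_ofReal.isClosedEmbedding.isClosed_range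
    exact frontier_subset_closure.trans
      (closure_minimal (filledJuliaCubic_real hc1 hB') hclosed)
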